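/- arXiv:1705.01361 — 2 statements merged into one kernel-verified Lean document; each statement's English description precedes it below -/
import Mathlib

section
/- For all integers m, m' ≥ 2 and n, n' ≥ 3, the torus-knot-type groups T(m,n) = ⟨a, b ∣ a^m = b^n⟩ and T(m',n') = ⟨a, b ∣ a^{m'} = b^{n'}⟩ are quasi-isometric. -/
/-- The torus-knot-type group `T(m,n) = ⟨a, b ∣ aᵐ = bⁿ⟩`, presented on the two generators
`a = FreeGroup.of true` and `b = FreeGroup.of false` with single relator `aᵐ b⁻ⁿ`. -/
abbrev TorusKnotGroup (m n : ℕ) : Type :=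
  PresentedGroup
    ({FreeGroup.of true ^ m * (FreeGroup.of false ^ n)⁻¹} : Set (FreeGroup Bool))
/-- The word metric on a group with respect to a generating set `S`: the least length of a
word in `S ∪ S⁻¹` expressing `x⁻¹ * y`. -/
noncomputable def wordDist {G : Type} [Group G] (S : Set G) (x y : G) : ℕ :=
  sInf {c | ∃ l : List G, l.length = c ∧ (∀ s ∈ l, s ∈ S ∨ s⁻¹ ∈ S) ∧ y = x * l.prod}

/-- Finitely generated groups `G` and `G'` are quasi-isometric: there are finite generating
sets, constants `L ≥ 1` and `C ≥ 0`, and a quasi-surjective `(L,C)`-quasi-isometric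
embedding `f : G → G'` for the corresponding word metrics. -/
def QuasiIsometricGroups (G G' : Type) [Group G] [Group G'] : Prop :=
  ∃ (S : Finset G) (S' : Finset G'),
    Subgroup.closure (S : Set G) = ⊤ ∧ Subgroup.closure (S' : Set G') = ⊤ ∧
    ∃ (L C : ℝ) (f : G → G'), 1 ≤ L ∧ 0 ≤ C ∧
      (∀ x y : G,
        (1 / L) * (wordDist (S : Set G) x y : ℝ) - C ≤
            (wordDist (S' : Set G') (f x) (f y) : ℝ) ∧
          (wordDist (S' : Set G') (f x) (f y) : ℝ) ≤
            L * (wordDist (S : Set G) x y : ℝ) + C) ∧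
      ∀ y : G', ∃ x : G, (wordDist (S' : Set G') (f x) y : ℝ) ≤ C

/-- `NearIn R k x y`: the points `x` and `y` are joined by a path of at most `k` edges of the
undirected graph underlying the relation `R`. -/
inductive NearIn {X : Type*} (R : X → X → Prop) : ℕ → X → X → Prop
  | refl (k : ℕ) (x : X) : NearIn R k x x
  | step {k : ℕ} {x y z : X} : NearIn R k x y → (R y z ∨ R z y) → NearIn R (k + 1) x z

namespace NearIn

variable {X Y : Type*} {R : X → X → Prop} {R' : Y → Y → Prop}

theorem mono {k l : ℕ} {x y : X} (h : NearIn R k x y) (hkl : k ≤ l) : NearIn R l x y := by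
  induction h generalizing l with
  | refl => exact refl _ _
  | step _ e ih =>
    obtain ⟨l, rfl⟩ : ∃ l', l = l' + 1 := ⟨l - 1, by omega⟩
    exact step (ih (by omega)) e

theorem of_rel {x y : X} (h : R x y) : NearIn R 1 x y := step (refl 0 x) (Or.inl h)

theorem trans {k l : ℕ} {x y z : X} (h : NearIn R k x y) (h' : NearIn R l y z) :
    NearIn R (k + l) x z := by
  induction h' with
  | refl => exact h.mono (by omega)
  | step _ e ih => exact step (ih h) e

theorem symm {k : ℕ} {x y : X} (h : NearIn R k x y) : NearIn R k y x := by
  induction h with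
  | refl => exact refl _ _
  | step _ e ih => exact ((step (refl 0 _) e.symm).trans ih).mono (by omega)

theorem map {f : X → Y} {K : ℕ} (hf : ∀ x x', R x x' → NearIn R' K (f x) (f x')) {k : ℕ}
    {x y : X} (h : NearIn R k x y) : NearIn R' (K * k) (f x) (f y) := by
  induction h with
  | refl => exact refl _ _
  | step _ e ih =>
    exact ih.trans (e.elim (hf _ _) fun e => (hf _ _ e).symm)

theorem map_rel {f : X → Y} (hf : ∀ x x', R x x' → R' (f x) (f x')) {k : ℕ}
    {x y : X} (h : NearIn R k x y) : NearIn R' k (f x) (f y) :=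
  (h.map (K := 1) fun x x' e => of_rel (hf x x' e)).mono (by omega)

end NearIn

/-- Two relations are coarsely equivalent if their underlying graphs are quasi-isometric: there
are Lipschitz maps in both directions that are inverse to each other up to bounded error. -/
def CoarseEquiv {X Y : Type*} (R : X → X → Prop) (R' : Y → Y → Prop) : Prop :=
  ∃ (f : X → Y) (g : Y → X) (K : ℕ),
    (∀ x x', R x x' → NearIn R' K (f x) (f x')) ∧ (∀ y y', R' y y' → NearIn R K (g y) (g y')) ∧
    (∀ x, NearIn R K (g (f x)) x) ∧ ∀ y, NearIn R' K (f (g y)) y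

/-- Adjacency in the Cartesian product of two graphs. -/
def BoxRel {X Y : Type*} (R : X → X → Prop) (R' : Y → Y → Prop) (u v : X × Y) : Prop :=
  R u.1 v.1 ∧ u.2 = v.2 ∨ u.1 = v.1 ∧ R' u.2 v.2

theorem NearIn.box_left {X Y : Type*} {R : X → X → Prop} {R' : Y → Y → Prop} {k : ℕ} {x x' : X}
    (h : NearIn R k x x') (y : Y) : NearIn (BoxRel R R') k (x, y) (x', y) :=
  h.map_rel (f := fun x => (x, y)) fun _ _ e => Or.inl ⟨e, rfl⟩

theorem NearIn.box_right {X Y : Type*} {R : X → X → Prop} {R' : Y → Y → Prop} {k : ℕ} {y y' : Y}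
    (h : NearIn R' k y y') (x : X) : NearIn (BoxRel R R') k (x, y) (x, y') :=
  h.map_rel (f := fun y => (x, y)) fun _ _ e => Or.inr ⟨rfl, e⟩

namespace CoarseEquiv

variable {X Y Z : Type*} {R : X → X → Prop} {R' : Y → Y → Prop} {R'' : Z → Z → Prop}

theorem symm (h : CoarseEquiv R R') : CoarseEquiv R' R := by
  obtain ⟨f, g, K, hf, hg, hgf, hfg⟩ := h
  exact ⟨g, f, K, hg, hf, hfg, hgf⟩

theorem trans (h : CoarseEquiv R R') (h' : CoarseEquiv R' R'') : CoarseEquiv R R'' := by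
  obtain ⟨f, g, K, hf, hg, hgf, hfg⟩ := h
  obtain ⟨f', g', K', hf', hg', hgf', hfg'⟩ := h'
  refine ⟨f' ∘ f, g ∘ g', K * K' + K + K', fun x x' e => ?_, fun y y' e => ?_, fun x => ?_,
    fun y => ?_⟩
  · exact ((hf x x' e).map hf').mono (by rw [mul_comm]; omega)
  · exact ((hg' y y' e).map hg).mono (by omega)
  · exact (((hgf' (f x)).map hg).trans (hgf x)).mono (by omega)
  · exact (((hfg (g' y)).map hf').trans (hfg' y)).mono (by rw [mul_comm K' K]; omega)

theorem box_right (h : CoarseEquiv R R') (S : Z → Z → Prop) :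
    CoarseEquiv (BoxRel R S) (BoxRel R' S) := by
  obtain ⟨f, g, K, hf, hg, hgf, hfg⟩ := h
  refine ⟨Prod.map f id, Prod.map g id, K + 1, ?_, ?_, fun x => ?_, fun y => ?_⟩
  · rintro ⟨x, z⟩ ⟨x', z'⟩ (⟨e, rfl : z = z'⟩ | ⟨rfl : x = x', e⟩)
    · exact ((hf x x' e).box_left z).mono (by omega)
    · exact ((NearIn.of_rel e).box_right (f x)).mono (by omega)
  · rintro ⟨x, z⟩ ⟨x', z'⟩ (⟨e, rfl : z = z'⟩ | ⟨rfl : x = x', e⟩)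
    · exact ((hg x x' e).box_left z).mono (by omega)
    · exact ((NearIn.of_rel e).box_right (g x)).mono (by omega)
  · exact ((hgf x.1).box_left x.2).mono (by omega)
  · exact ((hfg y.1).box_left y.2).mono (by omega)

end CoarseEquiv

/-- Adjacency in the Cayley graph of a group with respect to `S`. -/
def CayleyRel {G : Type*} [Group G] (S : Set G) (x y : G) : Prop := ∃ s ∈ S, y = x * s

section WordDist

variable {G G' : Type} [Group G] [Group G']

theorem NearIn.exists_list {S : Set G} {k : ℕ} {x y : G} (h : NearIn (CayleyRel S) k x y) :
    ∃ l : List G, l.length ≤ k ∧ (∀ s ∈ l, s ∈ S ∨ s⁻¹ ∈ S) ∧ y = x * l.prod := by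
  induction h with
  | refl k x => exact ⟨[], by simp⟩
  | @step k x y z _ e ih =>
    obtain ⟨l, hl, hS, rfl⟩ := ih
    obtain ⟨s, hs, hz⟩ : ∃ s, (s ∈ S ∨ s⁻¹ ∈ S) ∧ z = x * l.prod * s := by
      rcases e with ⟨s, hs, rfl⟩ | ⟨s, hs, hz⟩
      · exact ⟨s, Or.inl hs, rfl⟩
      · exact ⟨s⁻¹, Or.inr (by simpa using hs), by simp [hz]⟩
    refine ⟨l ++ [s], by simpa using hl, ?_, by simp [hz, mul_assoc]⟩
    intro t ht
    rcases List.mem_append.1 ht with ht | ht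
    · exact hS t ht
    · rwa [List.mem_singleton.1 ht]

theorem NearIn.wordDist_le {S : Set G} {k : ℕ} {x y : G} (h : NearIn (CayleyRel S) k x y) :
    wordDist S x y ≤ k := by
  obtain ⟨l, hl, hS, hy⟩ := h.exists_list
  exact le_trans (Nat.sInf_le (by exact ⟨l, rfl, hS, hy⟩)) hl

theorem nearIn_mul_prod {S : Set G} (l : List G) (hl : ∀ s ∈ l, s ∈ S ∨ s⁻¹ ∈ S) (x : G) :
    NearIn (CayleyRel S) l.length x (x * l.prod) := by
  induction l generalizing x with
  | nil => simpa using NearIn.refl 0 x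
  | cons s l ih =>
    have hs : NearIn (CayleyRel S) 1 x (x * s) :=
      (NearIn.refl 0 x).step <| (hl s (by simp)).imp (fun h => ⟨s, h, rfl⟩)
        fun h => ⟨s⁻¹, h, by simp⟩
    have := hs.trans (ih (fun t ht => hl t (by simp [ht])) (x * s))
    rw [List.prod_cons, ← mul_assoc]
    exact this.mono (by simp; omega)

theorem nearIn_wordDist {S : Set G} (hS : Subgroup.closure S = ⊤) (x y : G) :
    NearIn (CayleyRel S) (wordDist S x y) x y := by
  have hne : {c | ∃ l : List G, l.length = c ∧ (∀ s ∈ l, s ∈ S ∨ s⁻¹ ∈ S) ∧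
      y = x * l.prod}.Nonempty := by
    have hmem : x⁻¹ * y ∈ (Subgroup.closure S).toSubmonoid := by simp [hS]
    rw [Subgroup.closure_toSubmonoid] at hmem
    obtain ⟨l, hl, hprod⟩ := Submonoid.exists_list_of_mem_closure hmem
    exact ⟨_, l, rfl, hl, by simp [hprod]⟩
  obtain ⟨l, hlen, hl, hy⟩ := Nat.sInf_mem hne
  have := nearIn_mul_prod l hl x
  rwa [← hy, hlen] at this

theorem CoarseEquiv.quasiIsometricGroups {S : Finset G} {S' : Finset G'}
    (hS : Subgroup.closure (S : Set G) = ⊤) (hS' : Subgroup.closure (S' : Set G') = ⊤)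
    (h : CoarseEquiv (CayleyRel (S : Set G)) (CayleyRel (S' : Set G'))) :
    QuasiIsometricGroups G G' := by
  obtain ⟨f, g, K, hf, hg, hgf, hfg⟩ := h
  have hK : (0 : ℝ) ≤ K := Nat.cast_nonneg K
  refine ⟨S, S', hS, hS', K + 1, 2 * K, f, by linarith, by linarith, fun x y => ⟨?_, ?_⟩,
    fun y => ⟨g y, ?_⟩⟩
  · have key : wordDist (S : Set G) x y ≤ K + K * wordDist (S' : Set G') (f x) (f y) + K :=
      (((hgf x).symm.trans ((nearIn_wordDist hS' (f x) (f y)).map hg)).trans (hgf y)).wordDist_le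
    have key' : (wordDist (S : Set G) x y : ℝ) ≤
        K + K * wordDist (S' : Set G') (f x) (f y) + K := by exact_mod_cast key
    have hd : (0 : ℝ) ≤ wordDist (S' : Set G') (f x) (f y) := Nat.cast_nonneg _
    rw [sub_le_iff_le_add, one_div, inv_mul_le_iff₀ (by linarith)]
    nlinarith
  · have key : wordDist (S' : Set G') (f x) (f y) ≤ K * wordDist (S : Set G) x y :=
      ((nearIn_wordDist hS x y).map hf).wordDist_le
    have key' : (wordDist (S' : Set G') (f x) (f y) : ℝ) ≤ K * wordDist (S : Set G) x y := by
      exact_mod_cast key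
    have hd : (0 : ℝ) ≤ wordDist (S : Set G) x y := Nat.cast_nonneg _
    nlinarith
  · have key : (wordDist (S' : Set G') (f (g y)) y : ℝ) ≤ K := by
      exact_mod_cast (hfg y).wordDist_le
    linarith

end WordDist

/-- Adjacency in the disjoint union of rooted trees indexed by `ι`, each with branching `κ` and
vertices recorded as lists with the most recent branch first, with all the roots joined. -/
inductive ForestRel (ι κ : Type*) : ι × List κ → ι × List κ → Prop
  | root (i i' : ι) : ForestRel ι κ (i, []) (i', [])
  | child (i : ι) (l : List κ) (k : κ) : ForestRel ι κ (i, l) (i, k :: l)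

/-- Adjacency in the rooted binary tree. -/
def BinRel (l l' : List Bool) : Prop := ∃ b, l' = b :: l

/-- The `i`-th word of the complete prefix code `0, 01, 011, …, 01^(d-2), 1^(d-1)` of size `d`,
recorded with the most recent digit first. -/
def prefixCode (d i : ℕ) : List Bool :=
  if i + 1 < d then false :: List.replicate i true else List.replicate i true

namespace RootedForest

variable {N P : ℕ} {κ : Type*}

/-- The number of children of a vertex of the forest with an added root `none`. -/
def deg : Option (Fin N × List κ) → ℕ
  | none => N
  | some _ => P


theorem two_le_deg (hN : 2 ≤ N) (hP : 2 ≤ P) (w : Option (Fin N × List κ)) :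
    2 ≤ deg (P := P) w := by
  cases w <;> assumption

variable [NeZero N] [NeZero P] (e : κ ≃ Fin P)

/-- The `i`-th child of a vertex. -/
def child : Option (Fin N × List κ) → ℕ → Option (Fin N × List κ)
  | none, i => some (Fin.ofNat N i, [])
  | some (j, l), i => some (j, e.symm (Fin.ofNat P i) :: l)

/-- The binary word obtained by encoding each branch on the way from the root by `prefixCode`. -/
def encode : Option (Fin N × List κ) → List Bool
  | none => []
  | some (j, l) => l.foldr (fun k u => prefixCode P (e k) ++ u) (prefixCode N j)

/-- Reading a binary word: the vertex reached by the completely read code words, and the number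
of digits read after them. -/
def decode : List Bool → Option (Fin N × List κ) × ℕ
  | [] => (none, 0)
  | false :: l => (child e (decode l).1 (decode l).2, 0)
  | true :: l =>
    if (decode l).2 + 2 < deg (P := P) (decode l).1 then ((decode l).1, (decode l).2 + 1)
    else (child e (decode l).1 ((decode l).2 + 1), 0)

theorem encode_child {w : Option (Fin N × List κ)} {i : ℕ} (hi : i < deg (P := P) w) :
    encode e (child e w i) = prefixCode (deg (P := P) w) i ++ encode e w := by
  rcases w with _ | ⟨j, l⟩ <;> simp only [deg] at hi <;>
    simp [child, encode, deg, Nat.mod_eq_of_lt hi]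

theorem induction_child {p : Option (Fin N × List κ) → Prop} (root : p none)
    (step : ∀ w i, i < deg (P := P) w → p w → p (child e w i)) (w : Option (Fin N × List κ)) :
    p w := by
  have hstep : ∀ j : Fin N, ∀ l : List κ, p (some (j, l)) := by
    intro j l
    induction l with
    | nil => simpa [child] using step none j j.isLt root
    | cons k l ih => simpa [child] using step (some (j, l)) (e k) (e k).isLt ih
  rcases w with _ | ⟨j, l⟩
  exacts [root, hstep j l]

theorem decode_replicate_append {w : Option (Fin N × List κ)} {l : List Bool}
    (hl : decode e l = (w, 0)) {i : ℕ} (hi : i = 0 ∨ i + 1 < deg (P := P) w) :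
    decode e (List.replicate i true ++ l) = (w, i) := by
  induction i with
  | zero => simpa using hl
  | succ i ih =>
    have := ih (by omega)
    simp only [List.replicate_succ, List.cons_append, decode, this]
    rw [if_pos (by omega)]

theorem decode_encode (hN : 2 ≤ N) (hP : 2 ≤ P) (w : Option (Fin N × List κ)) :
    decode e (encode e w) = (w, 0) := by
  refine induction_child e (p := fun w => decode e (encode e w) = (w, 0)) rfl
    (fun w i hi ih => ?_) w
  have := two_le_deg hN hP w
  rw [encode_child e hi, prefixCode]
  split_ifs with h
  · simp only [List.cons_append, decode, decode_replicate_append e ih (Or.inr h)]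
  · obtain ⟨i, rfl⟩ : ∃ i', i = i' + 1 := ⟨i - 1, by omega⟩
    simp only [List.replicate_succ, List.cons_append, decode,
      decode_replicate_append e ih (i := i) (by omega)]
    rw [if_neg (by omega)]

theorem replicate_append_encode_decode (hN : 2 ≤ N) (hP : 2 ≤ P) (l : List Bool) :
    (decode (N := N) e l).2 + 1 < deg (P := P) (decode (N := N) e l).1 ∧
    List.replicate (decode (N := N) e l).2 true ++ encode e (decode (N := N) e l).1 = l := by
  induction l with
  | nil => exact ⟨two_le_deg hN hP _, rfl⟩
  | cons b l ih =>
    obtain ⟨h, h'⟩ := ih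
    cases b with
    | false =>
      refine ⟨two_le_deg hN hP _, ?_⟩
      simp only [decode]
      rw [encode_child e (by omega), prefixCode, if_pos h]
      simpa using h'
    | true =>
      simp only [decode]
      split_ifs with h2
      · exact ⟨h2, by simpa [List.replicate_succ] using h'⟩
      · refine ⟨two_le_deg hN hP _, ?_⟩
        rw [encode_child e (by omega), prefixCode, if_neg (by omega)]
        simpa [List.replicate_succ] using h'

end RootedForest

theorem nearIn_binRel_append (u l : List Bool) : NearIn BinRel u.length (u ++ l) l := by
  induction u with
  | nil => exact NearIn.refl _ _
  | cons b u ih =>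
    exact ((NearIn.of_rel (show BinRel (u ++ l) (b :: u ++ l) from ⟨b, rfl⟩)).symm.trans ih).mono
      (by simp [add_comm])

theorem nearIn_prefixCode_append {d : ℕ} (i : Fin d) (l : List Bool) :
    NearIn BinRel d (prefixCode d i ++ l) l := by
  refine (nearIn_binRel_append _ l).mono ?_
  unfold prefixCode
  split_ifs <;> simp

open RootedForest in
/-- A finite forest of at least two regular rooted trees, with the roots joined, is
quasi-isometric to the binary tree. -/
theorem coarseEquiv_forestRel_binRel {N P : ℕ} (hN : 2 ≤ N) (hP : 2 ≤ P) {κ : Type*}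
    (e : κ ≃ Fin P) : CoarseEquiv (ForestRel (Fin N) κ) BinRel := by
  have : NeZero N := ⟨by omega⟩
  have : NeZero P := ⟨by omega⟩
  let base : Fin N × List κ := (0, [])
  have hdeg (w : Option (Fin N × List κ)) : deg (P := P) w ≤ N + P := by
    cases w <;> simp [deg]
  have hchild (w : Option (Fin N × List κ)) (i : ℕ) :
      NearIn (ForestRel (Fin N) κ) 1 (w.getD base) ((child e w i).getD base) := by
    rcases w with _ | ⟨j, l⟩
    · exact NearIn.of_rel (ForestRel.root _ _)
    · exact NearIn.of_rel (ForestRel.child _ _ _)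
  have hroot (j : Fin N) : NearIn BinRel N (encode e (some (j, [])))
      (encode (N := N) e none) := by
    simpa [encode] using nearIn_prefixCode_append j []
  refine ⟨fun w => encode e (some w), fun l => (decode e l).1.getD base, 2 * N + P,
    ?_, ?_, fun w => ?_, fun l => ?_⟩
  · rintro _ _ (⟨j, j'⟩ | ⟨j, l, k⟩)
    · exact ((hroot j).trans (hroot j').symm).mono (by omega)
    · exact (nearIn_prefixCode_append (e k) _).symm.mono (by omega)
  · rintro l _ ⟨b, rfl⟩
    refine NearIn.mono (k := 1) ?_ (by omega)
    cases b with
    | false => exact hchild _ _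
    | true =>
      simp only [decode]
      split_ifs
      · exact NearIn.refl _ _
      · exact hchild _ _
  · simp only [decode_encode e hN hP]
    exact NearIn.refl _ _
  · obtain ⟨h, h'⟩ := replicate_append_encode_decode (N := N) e hN hP l
    have := hdeg (decode e l).1
    have hnear : NearIn BinRel (N + P) (encode e (decode (N := N) e l).1) l := by
      have := (nearIn_binRel_append (List.replicate (decode (N := N) e l).2 true)
        (encode e (decode (N := N) e l).1)).symm
      rw [h', List.length_replicate] at this
      exact this.mono (by omega)
    clear h h' this
    beta_reduce
    generalize (decode (N := N) e l).1 = w at *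
    cases w with
    | some w => exact hnear.mono (l := 2 * N + P) (by omega)
    | none => exact ((hroot 0).trans hnear).mono (l := 2 * N + P) (by omega)

namespace TorusKnot

/-- Reduced words `b ^ j * (a ^ (i₁ + 1) * b ^ (j₁ + 1)) * ⋯` not ending in a power of `a`, in the
free product of cyclic groups of orders `p + 1` and `q + 1`. -/
abbrev WordB (p q : ℕ) : Type := Fin (q + 1) × List (Fin p × Fin q)

/-- Reduced words not ending in a power of `b`: the empty word, or a word in `WordB p q` followed
by a nontrivial power of `a`. -/
abbrev WordA (p q : ℕ) : Type := Option (WordB p q × Fin p)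

/-- Adding a power of `a` to a word in `WordB p q` or a power of `b` to a word in `WordA p q` both
yield every reduced word exactly once. -/
def wordEquiv (p q : ℕ) : WordB p q × Fin (p + 1) ≃ WordA p q × Fin (q + 1) where
  toFun x := Fin.cases
    (match x.1 with
      | (j, []) => (none, j)
      | (j, (i, j') :: l) => (some ((j, l), i), j'.succ))
    (fun i => (some (x.1, i), 0)) x.2
  invFun y := match y.1 with
    | none => ((y.2, []), 0)
    | some (w, i) => Fin.cases (w, i.succ) (fun j => ((w.1, (i, j) :: w.2), 0)) y.2
  left_inv := by
    rintro ⟨⟨j, l⟩, i⟩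
    induction i using Fin.cases with
    | zero => rcases l with _ | ⟨⟨i, j'⟩, l⟩ <;> simp
    | succ i => simp
  right_inv := by
    rintro ⟨_ | ⟨w, i⟩, j⟩
    · simp
    · induction j using Fin.cases <;> simp

/-- The set `WordB p q × ℤ`, where `(w, z)` stands for `w * a ^ z`, is identified with
`WordA p q × ℤ`, where `(w, z)` stands for `w * b ^ z`, by means of `a ^ (p + 1) = b ^ (q + 1)`. -/
def normalFormEquiv (p q : ℕ) : WordB p q × ℤ ≃ WordA p q × ℤ :=
  ((Equiv.refl _).prodCongr ((Int.divModEquiv (p + 1)).trans (Equiv.prodComm _ _))).trans <|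
    (Equiv.prodAssoc _ _ _).symm.trans <|
    ((wordEquiv p q).prodCongr (Equiv.refl ℤ)).trans <|
    (Equiv.prodAssoc _ _ _).trans <|
    ((Equiv.refl _).prodCongr ((Int.divModEquiv (q + 1)).trans (Equiv.prodComm _ _))).symm

theorem exists_fin_add_mul (d : ℕ) (z : ℤ) :
    ∃ (i : Fin (d + 1)) (k : ℤ), z = i + (d + 1) * k := by
  refine ⟨(Int.divModEquiv (d + 1) z).2, (Int.divModEquiv (d + 1) z).1, ?_⟩
  conv_lhs => rw [← (Int.divModEquiv (d + 1)).symm_apply_apply z, Int.divModEquiv_symm_apply]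
  push_cast
  ring

theorem normalFormEquiv_apply {p q : ℕ} (w : WordB p q) (i : Fin (p + 1)) (k : ℤ) :
    normalFormEquiv p q (w, i + (p + 1) * k) =
      ((wordEquiv p q (w, i)).1, (wordEquiv p q (w, i)).2 + (q + 1) * k) := by
  have h : Int.divModEquiv (p + 1) (i + (p + 1) * k) = (k, i) := by
    rw [← Equiv.eq_symm_apply, Int.divModEquiv_symm_apply]
    push_cast
    ring
  simp only [normalFormEquiv, Equiv.trans_apply, Equiv.prodCongr_apply, Prod.map, h,
    Equiv.prodComm_apply, Prod.swap, Equiv.prodAssoc_symm_apply, Equiv.prodAssoc_apply,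
    Equiv.prodCongr_symm, Equiv.refl_apply, Equiv.refl_symm, Equiv.symm_trans_apply,
    Equiv.prodComm_symm, Int.divModEquiv_symm_apply]
  refine Prod.ext rfl ?_
  push_cast
  ring

/-- Adding one to the integer coordinate. -/
def shift (W : Type) : Equiv.Perm (W × ℤ) := (Equiv.refl W).prodCongr (Equiv.addRight 1)

theorem shift_pow_apply {W : Type} (k : ℕ) (x : W × ℤ) : (shift W ^ k) x = (x.1, x.2 + k) := by
  induction k with
  | zero => simp
  | succ k ih => rw [pow_succ', Equiv.Perm.mul_apply, ih]; simp [shift, add_assoc]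

/-- Right multiplication by `b` in terms of normal forms. -/
def stepB (p q : ℕ) : Equiv.Perm (WordB p q × ℤ) :=
  (normalFormEquiv p q).symm.permCongr (shift (WordA p q))

theorem stepB_pow (p q k : ℕ) :
    stepB p q ^ k = (normalFormEquiv p q).symm.permCongr (shift (WordA p q) ^ k) :=
  (map_pow (normalFormEquiv p q).symm.permCongrHom (shift (WordA p q)) k).symm

theorem shift_pow_eq_stepB_pow (p q : ℕ) : shift (WordB p q) ^ (p + 1) = stepB p q ^ (q + 1) := by
  ext1 ⟨w, z⟩
  obtain ⟨i, k, rfl⟩ := exists_fin_add_mul p z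
  rw [stepB_pow, Equiv.permCongr_apply, Equiv.eq_symm_apply, shift_pow_apply, shift_pow_apply,
    Equiv.symm_symm, normalFormEquiv_apply]
  have h : (i : ℤ) + (p + 1) * k + ((p + 1 : ℕ) : ℤ) = i + (p + 1) * (k + 1) := by
    push_cast
    ring
  rw [h, normalFormEquiv_apply]
  refine Prod.ext rfl ?_
  push_cast
  ring

variable {p q : ℕ}

/-- The generator `a`. -/
def genA (m n : ℕ) : TorusKnotGroup m n := PresentedGroup.of true

/-- The generator `b`. -/
def genB (m n : ℕ) : TorusKnotGroup m n := PresentedGroup.of false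

theorem genA_pow_eq_genB_pow (m n : ℕ) : genA m n ^ m = genB m n ^ n := by
  have := PresentedGroup.one_of_mem
    (rels := ({FreeGroup.of true ^ m * (FreeGroup.of false ^ n)⁻¹} : Set (FreeGroup Bool)))
    (Set.mem_singleton _)
  rw [map_mul, map_inv, map_pow, map_pow, mul_inv_eq_one] at this
  exact this

theorem closure_genA_genB (m n : ℕ) : Subgroup.closure {genA m n, genB m n} = ⊤ := by
  rw [← PresentedGroup.closure_range_of]
  congr 1
  ext x
  simp only [Set.mem_insert_iff, Set.mem_singleton_iff, Set.mem_range, Bool.exists_bool]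
  exact or_comm.trans (or_congr eq_comm eq_comm)

/-- The action of the torus knot group on normal forms for which `a` and `b` act by the inverses
of right multiplication. -/
def rep (p q : ℕ) : TorusKnotGroup (p + 1) (q + 1) →* Equiv.Perm (WordB p q × ℤ) :=
  PresentedGroup.toGroup (f := fun t => if t then (shift _)⁻¹ else (stepB p q)⁻¹) <| by
    rintro _ rfl
    simp [shift_pow_eq_stepB_pow]

/-- Right multiplication of normal forms by group elements. -/
def act (x : WordB p q × ℤ) (g : TorusKnotGroup (p + 1) (q + 1)) : WordB p q × ℤ := rep p q g⁻¹ x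

theorem act_one (x : WordB p q × ℤ) : act x 1 = x := by simp [act]

theorem act_mul (x : WordB p q × ℤ) (g h : TorusKnotGroup (p + 1) (q + 1)) :
    act x (g * h) = act (act x g) h := by
  simp [act]

theorem act_genA (x : WordB p q × ℤ) : act x (genA _ _) = shift _ x := by
  simp [act, rep, genA]

theorem act_genB (x : WordB p q × ℤ) : act x (genB _ _) = stepB p q x := by
  simp [act, rep, genB]

theorem act_genA_pow (x : WordB p q × ℤ) (k : ℕ) : act x (genA _ _ ^ k) = (x.1, x.2 + k) := by
  rw [← shift_pow_apply]
  simp [act, rep, genA]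

theorem act_genB_pow (x : WordB p q × ℤ) (k : ℕ) :
    act x (genB _ _ ^ k) = (stepB p q ^ k) x := by
  simp [act, rep, genB]

theorem normalFormEquiv_succ (w : WordB p q) (i : Fin p) :
    normalFormEquiv p q (w, i + 1) = (some (w, i), 0) := by
  simpa [wordEquiv] using normalFormEquiv_apply w i.succ 0

theorem normalFormEquiv_zero (w : WordB p q) :
    normalFormEquiv p q (w, 0) = ((wordEquiv p q (w, 0)).1, ((wordEquiv p q (w, 0)).2 : ℤ)) := by
  simpa using normalFormEquiv_apply w 0 0

/-- The group element represented by a word in `WordB p q`. -/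
def evalB (w : WordB p q) : TorusKnotGroup (p + 1) (q + 1) :=
  w.2.foldr (fun x g => g * (genA _ _ ^ (x.1 + 1 : ℕ) * genB _ _ ^ (x.2 + 1 : ℕ)))
    (genB _ _ ^ (w.1 : ℕ))

/-- The group element represented by a word in `WordA p q`. -/
def evalA : WordA p q → TorusKnotGroup (p + 1) (q + 1)
  | none => 1
  | some (w, i) => evalB w * genA _ _ ^ (i + 1 : ℕ)

/-- The group element represented by a normal form. -/
def eval (x : WordB p q × ℤ) : TorusKnotGroup (p + 1) (q + 1) := evalB x.1 * genA _ _ ^ x.2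

theorem evalB_mul_genA_pow (w : WordB p q) (i : Fin (p + 1)) :
    evalB w * genA _ _ ^ (i : ℕ) =
      evalA (wordEquiv p q (w, i)).1 * genB _ _ ^ ((wordEquiv p q (w, i)).2 : ℕ) := by
  obtain ⟨j, l⟩ := w
  induction i using Fin.cases with
  | zero => rcases l with _ | ⟨⟨i, j'⟩, l⟩ <;> simp [wordEquiv, evalA, evalB, mul_assoc]
  | succ i => simp [wordEquiv, evalA]

theorem genA_zpow_eq_genB_zpow (m n : ℕ) (k : ℤ) :
    genA m n ^ ((m : ℤ) * k) = genB m n ^ ((n : ℤ) * k) := by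
  rw [zpow_mul, zpow_mul, zpow_natCast, zpow_natCast, genA_pow_eq_genB_pow]

theorem eval_eq (x : WordB p q × ℤ) :
    eval x = evalA (normalFormEquiv p q x).1 * genB _ _ ^ (normalFormEquiv p q x).2 := by
  obtain ⟨w, z⟩ := x
  obtain ⟨i, k, rfl⟩ := exists_fin_add_mul p z
  have h := genA_zpow_eq_genB_zpow (p + 1) (q + 1) k
  push_cast at h
  rw [normalFormEquiv_apply, eval, zpow_add, zpow_add, h, zpow_natCast, zpow_natCast,
    ← mul_assoc, ← mul_assoc, evalB_mul_genA_pow]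

theorem commute_genA_pow (m n : ℕ) (g : TorusKnotGroup m n) : Commute (genA m n ^ m) g := by
  have hg : g ∈ Subgroup.closure {genA m n, genB m n} := by simp [closure_genA_genB]
  induction hg using Subgroup.closure_induction with
  | mem g hg =>
    rcases hg with rfl | rfl
    · exact (Commute.refl _).pow_left m
    · rw [genA_pow_eq_genB_pow]
      exact (Commute.refl _).pow_left n
  | one => exact Commute.one_right _
  | mul g h _ _ ihg ihh => exact ihg.mul_right ihh
  | inv g _ ih => exact ih.inv_right

theorem eval_shift (x : WordB p q × ℤ) : eval (shift _ x) = eval x * genA _ _ := by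
  simp [eval, shift, zpow_add_one, mul_assoc]

theorem eval_stepB (x : WordB p q × ℤ) : eval (stepB p q x) = eval x * genB _ _ := by
  simp [eval_eq, stepB, shift, zpow_add_one, mul_assoc]

theorem eval_act (x : WordB p q × ℤ) (g : TorusKnotGroup (p + 1) (q + 1)) :
    eval (act x g) = eval x * g := by
  have hg : g ∈ Subgroup.closure {genA (p + 1) (q + 1), genB (p + 1) (q + 1)} := by
    simp [closure_genA_genB]
  induction hg using Subgroup.closure_induction generalizing x with
  | mem g hg =>
    rcases hg with rfl | rfl
    · rw [act_genA, eval_shift]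
    · rw [act_genB, eval_stepB]
  | one => simp [act_one]
  | mul g h _ _ ihg ihh => rw [act_mul, ihh, ihg, mul_assoc]
  | inv g _ ih =>
    have := ih (act x g⁻¹)
    rw [← act_mul, inv_mul_cancel, act_one] at this
    rw [this, mul_inv_cancel_right]

theorem act_genA_zpow (w : WordB p q) (z : ℤ) : act (w, 0) (genA _ _ ^ z) = (w, z) := by
  obtain ⟨k, rfl | rfl⟩ := z.eq_nat_or_neg
  · simp [act_genA_pow]
  · have h : act (w, -(k : ℤ)) (genA (p + 1) (q + 1) ^ k) = (w, 0) := by simp [act_genA_pow]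
    rw [← h, ← act_mul]
    simp [act_one]

theorem act_genA_pow_mul_genB_pow (w : WordB p q) (i : Fin p) (j : Fin q) :
    act (w, 0) (genA _ _ ^ (i + 1 : ℕ) * genB _ _ ^ (j + 1 : ℕ)) =
      ((w.1, (i, j) :: w.2), 0) := by
  rw [act_mul, act_genA_pow, act_genB_pow, stepB_pow, Equiv.permCongr_apply,
    Equiv.symm_apply_eq, shift_pow_apply, normalFormEquiv_zero, Equiv.symm_symm]
  have h := normalFormEquiv_succ w i
  simp [h, wordEquiv]

theorem act_evalB (w : WordB p q) : act ((0, []), 0) (evalB w) = (w, 0) := by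
  obtain ⟨j, l⟩ := w
  induction l with
  | nil =>
    rw [evalB, List.foldr_nil, act_genB_pow, stepB_pow, Equiv.permCongr_apply,
      Equiv.symm_apply_eq, shift_pow_apply, Equiv.symm_symm, normalFormEquiv_zero,
      normalFormEquiv_zero]
    simp [wordEquiv]
  | cons x l ih =>
    have h : evalB (j, x :: l) = evalB (j, l) * (genA _ _ ^ (x.1 + 1 : ℕ) *
      genB _ _ ^ (x.2 + 1 : ℕ)) := rfl
    rw [h, act_mul, ih, act_genA_pow_mul_genB_pow]

theorem act_eval (x : WordB p q × ℤ) : act ((0, []), 0) (eval x) = x := by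
  rw [eval, act_mul, act_evalB, act_genA_zpow]

end TorusKnot

/-- Adjacency in the line with vertex set `ℤ`. -/
def IntRel (z z' : ℤ) : Prop := z' = z + 1

theorem nearIn_intRel_add (z : ℤ) (k : ℕ) : NearIn IntRel k z (z + k) := by
  induction k with
  | zero => simpa using NearIn.refl 0 z
  | succ k ih => exact ih.step (Or.inl (by simp [IntRel, add_assoc]))

theorem nearIn_cayleyRel_mul_pow {G : Type*} [Group G] {S : Set G} {s : G} (hs : s ∈ S) (x : G)
    (k : ℕ) : NearIn (CayleyRel S) k x (x * s ^ k) := by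
  induction k with
  | zero => simpa using NearIn.refl 0 x
  | succ k ih => exact ih.step (Or.inl ⟨s, hs, by simp [pow_succ, mul_assoc]⟩)

namespace TorusKnot

variable {p q : ℕ}

/-- Adjacency in the product of a forest and a line. -/
abbrev FormRel (p q : ℕ) : WordB p q × ℤ → WordB p q × ℤ → Prop :=
  BoxRel (ForestRel (Fin (q + 1)) (Fin p × Fin q)) IntRel

/-- Dropping the final power of `a` of a word and rounding the exponent of `b`. -/
def truncate (y : WordA p q × ℤ) : WordB p q × ℤ :=
  (y.1.elim (0, []) Prod.fst, (p + 1) * (y.2 / (q + 1)))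

theorem nearIn_truncate (x : WordB p q × ℤ) :
    NearIn (FormRel p q) (p + 1) x (truncate (normalFormEquiv p q x)) := by
  obtain ⟨⟨j, l⟩, z⟩ := x
  obtain ⟨i, k, rfl⟩ := exists_fin_add_mul p z
  have hk (t : Fin (q + 1)) : ((t : ℤ) + (q + 1) * k) / (q + 1) = k := by
    rw [Int.add_mul_ediv_left _ _ (by omega), Int.ediv_eq_zero_of_lt (by omega) (by omega),
      zero_add]
  rw [normalFormEquiv_apply, truncate, hk]
  induction i using Fin.cases with
  | zero =>
    refine NearIn.mono (k := 1) ?_ (by omega)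
    rcases l with _ | ⟨⟨i, j'⟩, l⟩
    · simpa [wordEquiv] using (NearIn.of_rel (ForestRel.root j 0)).box_left _
    · simpa [wordEquiv] using (NearIn.of_rel (ForestRel.child j l (i, j'))).symm.box_left _
  | succ i =>
    have := (nearIn_intRel_add ((p + 1) * k) (i + 1)).symm.mono (by omega : _ ≤ p + 1)
    rw [add_comm ((p + 1) * k)] at this
    simpa [wordEquiv] using this.box_right _

theorem nearIn_truncate_shift (y : WordA p q × ℤ) :
    NearIn (FormRel p q) (p + 1) (truncate y) (truncate (shift _ y)) := by
  obtain ⟨y, z⟩ := y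
  have h : (z + 1) / (q + 1 : ℤ) = z / (q + 1 : ℤ) ∨
      (z + 1) / (q + 1 : ℤ) = z / (q + 1 : ℤ) + 1 := by
    have h₁ : z / (q + 1 : ℤ) ≤ (z + 1) / (q + 1 : ℤ) :=
      Int.ediv_le_ediv (by omega) (by omega)
    have h₂ : (z + 1) / (q + 1 : ℤ) ≤ (z + (q + 1)) / (q + 1 : ℤ) :=
      Int.ediv_le_ediv (by omega) (by omega)
    rw [Int.add_ediv_of_dvd_right (dvd_refl _), Int.ediv_self (by omega)] at h₂
    omega
  simp only [truncate, shift, Equiv.prodCongr_apply, Prod.map, Equiv.refl_apply,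
    Equiv.coe_addRight]
  rcases h with h | h <;> rw [h]
  · exact NearIn.refl _ _
  · rw [mul_add, mul_one]
    have := nearIn_intRel_add ((p + 1) * (z / (q + 1 : ℤ))) (p + 1)
    push_cast at this
    exact this.box_right _

theorem nearIn_stepB (x : WordB p q × ℤ) :
    NearIn (FormRel p q) (3 * (p + 1)) x (stepB p q x) := by
  have h := nearIn_truncate (stepB p q x)
  rw [stepB, Equiv.permCongr_apply, Equiv.apply_symm_apply, Equiv.symm_symm] at h
  exact (((nearIn_truncate x).trans (nearIn_truncate_shift _)).trans h.symm).mono (by omega)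

theorem nearIn_eval_of_evalB {u v : WordB p q} {C : ℕ}
    (h : NearIn (CayleyRel {genA (p + 1) (q + 1), genB (p + 1) (q + 1)}) C (evalB u) (evalB v))
    (z : ℤ) :
    NearIn (CayleyRel {genA (p + 1) (q + 1), genB (p + 1) (q + 1)}) (p + C + p) (eval (u, z))
      (eval (v, z)) := by
  obtain ⟨i, k, rfl⟩ := exists_fin_add_mul p z
  have heval (w : WordB p q) : eval (w, (i + (p + 1) * k : ℤ)) =
      (genA _ _ ^ (p + 1)) ^ k * evalB w * genA _ _ ^ (i : ℕ) := by
    have hk : genA (p + 1) (q + 1) ^ ((p + 1) * k : ℤ) = (genA _ _ ^ (p + 1)) ^ k := by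
      rw [zpow_mul]
      norm_cast
    rw [eval, add_comm (i : ℤ), zpow_add, hk, zpow_natCast, ← mul_assoc,
      ((commute_genA_pow _ _ (evalB w)).zpow_left k).eq]
  have htail (g : TorusKnotGroup (p + 1) (q + 1)) :=
    (nearIn_cayleyRel_mul_pow (S := {genA (p + 1) (q + 1), genB (p + 1) (q + 1)})
      (Set.mem_insert _ _) g i).mono (Nat.lt_succ_iff.1 i.isLt)
  rw [heval, heval]
  refine ((htail _).symm.trans (h.map_rel ?_)).trans (htail _)
  rintro x _ ⟨s, hs, rfl⟩
  exact ⟨s, hs, (mul_assoc _ _ _).symm⟩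

theorem nearIn_eval {x y : WordB p q × ℤ} (h : FormRel p q x y) :
    NearIn (CayleyRel {genA (p + 1) (q + 1), genB (p + 1) (q + 1)}) (3 * (p + q + 1)) (eval x)
      (eval y) := by
  have hA : genA (p + 1) (q + 1) ∈ ({genA _ _, genB _ _} : Set (TorusKnotGroup _ _)) := by simp
  have hB : genB (p + 1) (q + 1) ∈ ({genA _ _, genB _ _} : Set (TorusKnotGroup _ _)) := by simp
  obtain ⟨u, z⟩ := x
  obtain ⟨v, z'⟩ := y
  rcases h with ⟨h, rfl : z = z'⟩ | ⟨rfl : u = v, rfl : z' = z + 1⟩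
  · rcases h with ⟨j, j'⟩ | ⟨j, l, i, j'⟩
    · have hj (j : Fin (q + 1)) := nearIn_cayleyRel_mul_pow hB 1 j
      simp only [one_mul] at hj
      exact (nearIn_eval_of_evalB (u := (j, [])) (v := (j', []))
        ((hj j).symm.trans (hj j')) z).mono (by omega)
    · have h := (nearIn_cayleyRel_mul_pow hA (evalB (j, l)) (i + 1)).trans
        (nearIn_cayleyRel_mul_pow hB _ (j' + 1))
      rw [mul_assoc] at h
      exact (nearIn_eval_of_evalB (v := (j, (i, j') :: l)) h z).mono (by omega)
  · exact (NearIn.of_rel ⟨_, hA, eval_shift (u, z)⟩).mono (by omega)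

theorem coarseEquiv_formRel (p q : ℕ) :
    CoarseEquiv (CayleyRel {genA (p + 1) (q + 1), genB (p + 1) (q + 1)}) (FormRel p q) := by
  refine ⟨act ((0, []), 0), eval, 3 * (p + q + 1), ?_, fun x y h => ?_, fun g => ?_, fun x => ?_⟩
  · rintro g _ ⟨s, rfl | rfl, rfl⟩
    · rw [act_mul, act_genA]
      exact (NearIn.box_right (NearIn.of_rel (R := IntRel) rfl) _).mono (by omega : 1 ≤ _)
    · rw [act_mul, act_genB]
      exact (nearIn_stepB _).mono (by omega)
  · exact nearIn_eval h
  · rw [eval_act]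
    simpa [eval, evalB] using NearIn.refl _ _
  · rw [act_eval]
    exact NearIn.refl _ _

end TorusKnot

open TorusKnot in
theorem torusKnotGroup_coarseEquiv {m n : ℕ} (hm : 2 ≤ m) (hn : 3 ≤ n) :
    CoarseEquiv (CayleyRel {genA m n, genB m n}) (BoxRel BinRel IntRel) := by
  obtain ⟨p, rfl⟩ : ∃ p, m = p + 1 := ⟨m - 1, by omega⟩
  obtain ⟨q, rfl⟩ : ∃ q, n = q + 1 := ⟨n - 1, by omega⟩
  have hpq : 2 ≤ p * q := le_trans (by omega : 2 ≤ 1 * q) (Nat.mul_le_mul_right q (by omega))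
  exact (coarseEquiv_formRel p q).trans
    ((coarseEquiv_forestRel_binRel (by omega) hpq finProdFinEquiv).box_right IntRel)

/-- **Theorem A.5(III), group-level.** For all `m, m' ≥ 2` and `n, n' ≥ 3`, the
torus-knot-type groups `⟨a, b ∣ aᵐ = bⁿ⟩` and `⟨a, b ∣ a^{m'} = b^{n'}⟩` are
quasi-isometric. -/
theorem torusKnotGroup_quasiIsometric
    (m n m' n' : ℕ) (hm : 2 ≤ m) (hn : 3 ≤ n) (hm' : 2 ≤ m') (hn' : 3 ≤ n') :
    QuasiIsometricGroups (TorusKnotGroup m n) (TorusKnotGroup m' n') := by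
  classical
  have h := (torusKnotGroup_coarseEquiv hm hn).trans (torusKnotGroup_coarseEquiv hm' hn').symm
  refine CoarseEquiv.quasiIsometricGroups (S := {TorusKnot.genA m n, TorusKnot.genB m n})
    (S' := {TorusKnot.genA m' n', TorusKnot.genB m' n'}) ?_ ?_ (by simpa using h)
  · simpa using TorusKnot.closure_genA_genB m n
  · simpa using TorusKnot.closure_genA_genB m' n'
end

section
/- For every integer m, n ≥ 1, the group T(m,n) = ⟨a, b ∣ a^m = b^n⟩ contains a subgroup of index m·n that is isomorphic to F × ℤ, where F is the free group of rank mn − m − n + 1. -/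
namespace TorusKnotGroup

section Rotation

variable {α : Type*} {p : ℕ}

/-- The permutation of `Fin (p + 1) × α` which rotates the first factor and applies `Z` to the
second one whenever the rotation wraps around. -/
def twistedRotation (p : ℕ) (Z : Equiv.Perm α) : Equiv.Perm (Fin (p + 1) × α) :=
  Equiv.prodShear (finRotate (p + 1)) fun i => if i = Fin.last p then Z else 1

theorem twistedRotation_last (Z : Equiv.Perm α) (x : α) :
    twistedRotation p Z (Fin.last p, x) = (0, Z x) := by
  simp [twistedRotation]

theorem twistedRotation_castSucc (Z : Equiv.Perm α) (i : Fin p) (x : α) :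
    twistedRotation p Z (i.castSucc, x) = (i.succ, x) := by
  simp [twistedRotation, Fin.castSucc_ne_last]

theorem twistedRotation_pow_apply_zero (Z : Equiv.Perm α) (i : Fin (p + 1)) (x : α) :
    (twistedRotation p Z ^ (i : ℕ)) (0, x) = (i, x) := by
  induction i using Fin.induction with
  | zero => simp
  | succ i ih =>
    rw [Fin.val_succ, pow_succ', Equiv.Perm.mul_apply]
    rw [Fin.val_castSucc] at ih
    rw [ih, twistedRotation_castSucc]

theorem twistedRotation_pow_apply (Z : Equiv.Perm α) (i : Fin (p + 1)) (x : α) :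
    (twistedRotation p Z ^ (p + 1)) (i, x) = (i, Z x) := by
  have hzero (y : α) : (twistedRotation p Z ^ (p + 1)) (0, y) = (0, Z y) := by
    have := twistedRotation_pow_apply_zero Z (Fin.last p) y
    rw [Fin.val_last] at this
    rw [pow_succ', Equiv.Perm.mul_apply, this, twistedRotation_last]
  rw [← twistedRotation_pow_apply_zero Z i x, ← Equiv.Perm.mul_apply, pow_mul_comm,
    Equiv.Perm.mul_apply, hzero, twistedRotation_pow_apply_zero]

end Rotation

variable (p q : ℕ)

/-- The direct product of a free group of rank `p * q` and `ℤ`. -/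
abbrev FreeProdInt : Type := FreeGroup (Fin p × Fin q) × Multiplicative ℤ

variable {p q}

/-- The family of generators of the free group, extended by `1` to the indices for which one
coordinate vanishes. -/
def gen (i : Fin (p + 1)) (j : Fin (q + 1)) : FreeGroup (Fin p × Fin q) :=
  Fin.cases 1 (fun i' => Fin.cases 1 (fun j' => FreeGroup.of (i', j')) j) i

@[simp] theorem gen_zero_left (j : Fin (q + 1)) : gen (0 : Fin (p + 1)) j = 1 := rfl

@[simp] theorem gen_zero_right (i : Fin (p + 1)) : gen i (0 : Fin (q + 1)) = 1 := by
  cases i using Fin.cases <;> rfl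

@[simp] theorem gen_succ_succ (i : Fin p) (j : Fin q) :
    gen i.succ j.succ = FreeGroup.of (i, j) := rfl

variable (p q)

/-- The set on which the torus knot group acts simply transitively. -/
abbrev Model : Type := Fin (p + 1) × Fin (q + 1) × FreeProdInt p q

/-- Left multiplication by the generator of `ℤ` on the last factor. -/
def shift (α : Type*) : Equiv.Perm (α × FreeProdInt p q) :=
  Equiv.prodCongr (Equiv.refl α) (Equiv.mulLeft (1, Multiplicative.ofAdd 1))

/-- The fibrewise left multiplication by the elements `gen i j`. -/
def gauge : Equiv.Perm (Model p q) :=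
  Equiv.prodShear (Equiv.refl _) fun i =>
    Equiv.prodShear (Equiv.refl _) fun j => Equiv.mulLeft (gen i j, 1)

/-- The twisted rotation of the second factor of the model. -/
def rotateSnd : Equiv.Perm (Model p q) :=
  Equiv.prodCongr (Equiv.refl _)
    (twistedRotation q (Equiv.mulLeft ((1, Multiplicative.ofAdd 1) : FreeProdInt p q)))

/-- The action of the first generator on the model. -/
def permA : Equiv.Perm (Model p q) := twistedRotation p (shift p q (Fin (q + 1)))

/-- The action of the second generator on the model. -/
def permB : Equiv.Perm (Model p q) := (gauge p q)⁻¹ * rotateSnd p q * gauge p q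

variable {p q}

theorem gauge_apply (i : Fin (p + 1)) (j : Fin (q + 1)) (k : FreeProdInt p q) :
    gauge p q (i, j, k) = (i, j, (gen i j, 1) * k) := rfl

theorem gauge_inv_apply (i : Fin (p + 1)) (j : Fin (q + 1)) (k : FreeProdInt p q) :
    (gauge p q)⁻¹ (i, j, k) = (i, j, (gen i j, 1)⁻¹ * k) := by
  rw [Equiv.Perm.inv_eq_iff_eq, gauge_apply, mul_inv_cancel_left]

theorem rotateSnd_pow_apply (r : ℕ) (i : Fin (p + 1)) (x : Fin (q + 1) × FreeProdInt p q) :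
    (rotateSnd p q ^ r) (i, x) =
      (i, (twistedRotation q (Equiv.mulLeft (1, Multiplicative.ofAdd 1)) ^ r) x) := by
  induction r with
  | zero => rfl
  | succ r ih => rw [pow_succ', Equiv.Perm.mul_apply, ih, pow_succ', Equiv.Perm.mul_apply]; rfl

theorem permB_pow (r : ℕ) :
    permB p q ^ r = (gauge p q)⁻¹ * rotateSnd p q ^ r * gauge p q := by
  simpa [permB] using conj_pow (a := (gauge p q)⁻¹) (b := rotateSnd p q) (i := r)

theorem permA_pow_apply_zero (i : Fin (p + 1)) (x : Fin (q + 1) × FreeProdInt p q) :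
    (permA p q ^ (i : ℕ)) (0, x) = (i, x) :=
  twistedRotation_pow_apply_zero _ i x

theorem permB_pow_apply_zero (i : Fin (p + 1)) (j : Fin (q + 1)) (k : FreeProdInt p q) :
    (permB p q ^ (j : ℕ)) (i, 0, k) = (i, j, (gen i j, 1)⁻¹ * k) := by
  rw [permB_pow, Equiv.Perm.mul_apply, Equiv.Perm.mul_apply, gauge_apply, rotateSnd_pow_apply,
    twistedRotation_pow_apply_zero, gauge_inv_apply, gen_zero_right, ← Prod.one_eq_mk, one_mul]

theorem permA_pow_apply (i : Fin (p + 1)) (j : Fin (q + 1)) (k : FreeProdInt p q) :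
    (permA p q ^ (p + 1)) (i, j, k) = (i, j, (1, Multiplicative.ofAdd 1) * k) :=
  twistedRotation_pow_apply _ i (j, k)

theorem permB_pow_apply (i : Fin (p + 1)) (j : Fin (q + 1)) (k : FreeProdInt p q) :
    (permB p q ^ (q + 1)) (i, j, k) = (i, j, (1, Multiplicative.ofAdd 1) * k) := by
  rw [permB_pow, Equiv.Perm.mul_apply, Equiv.Perm.mul_apply, gauge_apply, rotateSnd_pow_apply,
    twistedRotation_pow_apply, gauge_inv_apply]
  ext <;> simp

theorem permA_pow_eq_permB_pow : permA p q ^ (p + 1) = permB p q ^ (q + 1) :=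
  Equiv.ext fun ⟨i, j, k⟩ => (permA_pow_apply i j k).trans (permB_pow_apply i j k).symm

/-- The generator `a` of the torus knot group. -/
def a (m n : ℕ) : TorusKnotGroup m n := PresentedGroup.of true

/-- The generator `b` of the torus knot group. -/
def b (m n : ℕ) : TorusKnotGroup m n := PresentedGroup.of false

theorem a_pow_eq_b_pow (m n : ℕ) : a m n ^ m = b m n ^ n :=
  mul_inv_eq_one.mp <| PresentedGroup.one_of_mem
    (rels := {FreeGroup.of true ^ m * (FreeGroup.of false ^ n)⁻¹}) rfl

theorem closure_a_b (m n : ℕ) : Subgroup.closure {a m n, b m n} = ⊤ := by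
  rw [← PresentedGroup.closure_range_of, Bool.range_eq, Set.pair_comm]
  rfl

theorem commute_a_pow (m n : ℕ) (g : TorusKnotGroup m n) : Commute (a m n ^ m) g := by
  have hg : g ∈ Subgroup.closure {a m n, b m n} := closure_a_b m n ▸ Subgroup.mem_top g
  induction hg using Subgroup.closure_induction with
  | mem x hx =>
    rcases hx with rfl | rfl
    · exact Commute.pow_self _ _
    · exact a_pow_eq_b_pow m n ▸ Commute.pow_self _ _
  | one => exact Commute.one_right _
  | mul x y _ _ hx hy => exact hx.mul_right hy
  | inv x _ hx => exact hx.inv_right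

variable (p q)

/-- The action of the torus knot group on the model. -/
def action : TorusKnotGroup (p + 1) (q + 1) →* Equiv.Perm (Model p q) :=
  PresentedGroup.toGroup (f := fun c => cond c (permA p q) (permB p q)) <| by
    rintro _ rfl
    simp [permA_pow_eq_permB_pow]

theorem action_a : action p q (a _ _) = permA p q := PresentedGroup.toGroup.of _

theorem action_b : action p q (b _ _) = permB p q := PresentedGroup.toGroup.of _

/-- The homomorphism from the free group sending `gen i j` to a commutator of powers of the
generators. -/
def freeHom : FreeGroup (Fin p × Fin q) →* TorusKnotGroup (p + 1) (q + 1) :=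
  FreeGroup.lift fun x =>
    (b _ _ ^ (x.2.succ : ℕ) * a _ _ ^ (x.1.succ : ℕ))⁻¹ *
      (a _ _ ^ (x.1.succ : ℕ) * b _ _ ^ (x.2.succ : ℕ))

/-- The embedding of the product of a free group and `ℤ` into the torus knot group. -/
def embedding : FreeProdInt p q →* TorusKnotGroup (p + 1) (q + 1) :=
  (freeHom p q).noncommCoprod (zpowersHom _ (a _ _ ^ (p + 1))) fun _ t => by
    rw [zpowersHom_apply]
    exact ((commute_a_pow _ _ _).zpow_left t.toAdd).symm

variable {p q}

theorem freeHom_gen (i : Fin (p + 1)) (j : Fin (q + 1)) :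
    freeHom p q (gen i j) =
      (b _ _ ^ (j : ℕ) * a _ _ ^ (i : ℕ))⁻¹ * (a _ _ ^ (i : ℕ) * b _ _ ^ (j : ℕ)) := by
  cases i using Fin.cases with
  | zero => simp
  | succ i =>
    cases j using Fin.cases with
    | zero => simp
    | succ j => rw [gen_succ_succ, freeHom, FreeGroup.lift_apply_of]

theorem embedding_apply (f : FreeGroup (Fin p × Fin q)) (t : Multiplicative ℤ) :
    embedding p q (f, t) = freeHom p q f * (a _ _ ^ (p + 1)) ^ t.toAdd := rfl

theorem embedding_gen (i : Fin (p + 1)) (j : Fin (q + 1)) :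
    embedding p q (gen i j, 1) =
      (b _ _ ^ (j : ℕ) * a _ _ ^ (i : ℕ))⁻¹ * (a _ _ ^ (i : ℕ) * b _ _ ^ (j : ℕ)) := by
  rw [embedding_apply, freeHom_gen, toAdd_one, zpow_zero, mul_one]

theorem embedding_int : embedding p q (1, Multiplicative.ofAdd 1) = a _ _ ^ (p + 1) := by
  rw [embedding_apply, map_one, one_mul, toAdd_ofAdd, zpow_one]

/-- The map from the model to the torus knot group inverse to the orbit map. -/
def ofModel (s : Model p q) : TorusKnotGroup (p + 1) (q + 1) :=
  a _ _ ^ (s.1 : ℕ) * b _ _ ^ (s.2.1 : ℕ) * embedding p q s.2.2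

theorem ofModel_permA (s : Model p q) : ofModel (permA p q s) = a _ _ * ofModel s := by
  obtain ⟨i, j, k⟩ := s
  cases i using Fin.lastCases with
  | last =>
    rw [permA, twistedRotation_last]
    simp only [ofModel, shift, Equiv.prodCongr_apply, Prod.map, Equiv.refl_apply, Equiv.coe_mulLeft,
      map_mul, embedding_int, Fin.val_zero, Fin.val_last, pow_zero, one_mul]
    rw [← mul_assoc, ← (commute_a_pow _ _ (b _ _ ^ (j : ℕ))).eq, pow_succ' (a _ _)]
    simp only [mul_assoc]
  | cast i =>
    rw [permA, twistedRotation_castSucc]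
    simp only [ofModel, Fin.val_succ, Fin.val_castSucc, pow_succ', mul_assoc]

theorem ofModel_gauge_inv (i : Fin (p + 1)) (j : Fin (q + 1)) (k : FreeProdInt p q) :
    ofModel ((gauge p q)⁻¹ (i, j, k)) =
      b _ _ ^ (j : ℕ) * a _ _ ^ (i : ℕ) * embedding p q k := by
  rw [gauge_inv_apply, ofModel, map_mul, map_inv, embedding_gen]
  group

theorem ofModel_gauge_inv_rotateSnd (s : Model p q) :
    ofModel ((gauge p q)⁻¹ (rotateSnd p q s)) = b _ _ * ofModel ((gauge p q)⁻¹ s) := by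
  obtain ⟨i, j, k⟩ := s
  rw [rotateSnd, Equiv.prodCongr_apply, Prod.map_apply, Equiv.refl_apply]
  cases j using Fin.lastCases with
  | last =>
    rw [twistedRotation_last, ofModel_gauge_inv, ofModel_gauge_inv, Equiv.coe_mulLeft, map_mul,
      embedding_int, Fin.val_last, Fin.val_zero, pow_zero, one_mul, ← mul_assoc,
      ← (commute_a_pow _ _ (a _ _ ^ (i : ℕ))).eq, a_pow_eq_b_pow, pow_succ' (b _ _)]
    simp only [mul_assoc]
  | cast j =>
    rw [twistedRotation_castSucc, ofModel_gauge_inv, ofModel_gauge_inv, Fin.val_succ, Fin.val_castSucc,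
      pow_succ' (b _ _)]
    simp only [mul_assoc]

theorem ofModel_permB (s : Model p q) : ofModel (permB p q s) = b _ _ * ofModel s := by
  rw [permB, Equiv.Perm.mul_apply, Equiv.Perm.mul_apply, ofModel_gauge_inv_rotateSnd,
    ← Equiv.Perm.mul_apply, inv_mul_cancel, Equiv.Perm.one_apply]

theorem ofModel_action (g : TorusKnotGroup (p + 1) (q + 1)) (s : Model p q) :
    ofModel (action p q g s) = g * ofModel s := by
  have hg : g ∈ Subgroup.closure {a (p + 1) (q + 1), b _ _} := closure_a_b _ _ ▸ Subgroup.mem_top g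
  induction hg using Subgroup.closure_induction generalizing s with
  | mem x hx =>
    rcases hx with rfl | rfl
    · rw [action_a, ofModel_permA]
    · rw [action_b, ofModel_permB]
  | one => simp
  | mul x y _ _ hx hy => rw [map_mul, Equiv.Perm.mul_apply, hx, hy, mul_assoc]
  | inv x _ hx =>
    rw [eq_inv_mul_iff_mul_eq, ← hx, ← Equiv.Perm.mul_apply, ← map_mul, mul_inv_cancel, map_one,
      Equiv.Perm.one_apply]

theorem action_freeHom_apply (f : FreeGroup (Fin p × Fin q)) (k : FreeProdInt p q) :
    action p q (freeHom p q f) (0, 0, k) = (0, 0, (f, 1) * k) := by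
  have hof (x : Fin p × Fin q) (k : FreeProdInt p q) :
      action p q (freeHom p q (FreeGroup.of x)) (0, 0, k) = (0, 0, (FreeGroup.of x, 1) * k) := by
    rw [← gen_succ_succ, freeHom_gen, map_mul, map_inv, Equiv.Perm.mul_apply,
      Equiv.Perm.inv_eq_iff_eq]
    simp only [map_mul, map_pow, action_a, action_b, Equiv.Perm.mul_apply, permA_pow_apply_zero,
      permB_pow_apply_zero, gen_zero_left, ← Prod.one_eq_mk, inv_one, one_mul,
      inv_mul_cancel_left]
  induction f using FreeGroup.induction_on generalizing k with
  | C1 => simp [← Prod.one_eq_mk]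
  | of x => exact hof x k
  | inv_of x _ =>
    rw [map_inv, map_inv, Equiv.Perm.inv_eq_iff_eq, hof, ← mul_assoc]
    simp [← Prod.one_eq_mk]
  | mul f g hf hg =>
    rw [map_mul, map_mul, Equiv.Perm.mul_apply, hg, hf, ← mul_assoc]
    simp

theorem action_a_pow_zpow_apply (t : ℤ) (s : Model p q) :
    action p q ((a _ _ ^ (p + 1)) ^ t) s =
      (s.1, s.2.1, (1, Multiplicative.ofAdd t) * s.2.2) := by
  have hpow (s : Model p q) : action p q (a _ _ ^ (p + 1)) s =
      (s.1, s.2.1, (1, Multiplicative.ofAdd 1) * s.2.2) := by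
    rw [map_pow, action_a]
    exact permA_pow_apply s.1 s.2.1 s.2.2
  have hinv (s : Model p q) : (action p q (a _ _ ^ (p + 1)))⁻¹ s =
      (s.1, s.2.1, (1, Multiplicative.ofAdd 1)⁻¹ * s.2.2) := by
    rw [Equiv.Perm.inv_eq_iff_eq, hpow, mul_inv_cancel_left]
  induction t using Int.induction_on generalizing s with
  | zero => simp [← Prod.one_eq_mk]
  | succ t ih =>
    rw [zpow_add_one, map_mul, Equiv.Perm.mul_apply, ih, hpow, ← mul_assoc]
    simp [ofAdd_add]
  | pred t ih =>
    rw [zpow_sub_one, map_mul, Equiv.Perm.mul_apply, ih, map_inv, hinv, ← mul_assoc]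
    simp [sub_eq_add_neg, ofAdd_add]

theorem action_embedding_apply (k : FreeProdInt p q) :
    action p q (embedding p q k) (0, 0, 1) = (0, 0, k) := by
  obtain ⟨f, t⟩ := k
  rw [embedding_apply, map_mul, Equiv.Perm.mul_apply,
    action_a_pow_zpow_apply, action_freeHom_apply]
  simp

theorem embedding_injective : Function.Injective (embedding p q) := fun k l h => by
  have := action_embedding_apply k
  rw [h, action_embedding_apply] at this
  simpa using this.symm

theorem action_ofModel (s : Model p q) : action p q (ofModel s) (0, 0, 1) = s := by
  obtain ⟨i, j, k⟩ := s
  rw [ofModel, map_mul, map_mul, Equiv.Perm.mul_apply, action_embedding_apply, Equiv.Perm.mul_apply,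
    map_pow, map_pow, action_a, action_b, permB_pow_apply_zero, permA_pow_apply_zero,
    gen_zero_left, ← Prod.one_eq_mk, inv_one, one_mul]

theorem ofModel_action_base (g : TorusKnotGroup (p + 1) (q + 1)) :
    ofModel (action p q g (0, 0, 1)) = g := by
  rw [ofModel_action]
  simp [ofModel]

theorem index_range_embedding : (embedding p q).range.index = (p + 1) * (q + 1) := by
  have hbij : Function.Bijective fun x : Fin (p + 1) × Fin (q + 1) =>
      ((a _ _ ^ (x.1 : ℕ) * b _ _ ^ (x.2 : ℕ) : TorusKnotGroup (p + 1) (q + 1)) :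
        TorusKnotGroup (p + 1) (q + 1) ⧸ (embedding p q).range) := by
    constructor
    · rintro ⟨i, j⟩ ⟨i', j'⟩ h
      obtain ⟨k, hk⟩ := QuotientGroup.eq.mp h
      have hmodel : ofModel (i, j, k) = ofModel (i', j', 1) := by
        rw [ofModel, ofModel, hk, mul_inv_cancel_left, map_one, mul_one]
      have := congrArg (fun g => action p q g (0, 0, 1)) hmodel
      simp only [action_ofModel, Prod.mk.injEq] at this
      exact Prod.ext this.1 this.2.1
    · intro y
      obtain ⟨g, rfl⟩ := QuotientGroup.mk_surjective y
      let s := action p q g (0, 0, 1)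
      refine ⟨(s.1, s.2.1), QuotientGroup.eq.mpr ⟨s.2.2, ?_⟩⟩
      rw [eq_inv_mul_iff_mul_eq]
      exact ofModel_action_base g
  rw [Subgroup.index, ← Nat.card_eq_of_bijective _ hbij]
  simp

end TorusKnotGroup

/-- **Lemma 3.3, group-theoretic content.** For all `m, n ≥ 1`, the group
`T(m,n) = ⟨a, b ∣ aᵐ = bⁿ⟩` contains a subgroup of index `m·n` isomorphic to `F × ℤ`,
where `F` is the free group of rank `mn − m − n + 1`. -/
theorem torusKnotGroup_finiteIndex_free_times_int
    (m n : ℕ) (hm : 1 ≤ m) (hn : 1 ≤ n) :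
    ∃ H : Subgroup (TorusKnotGroup m n), H.index = m * n ∧
      Nonempty
        (H ≃* FreeGroup (Fin ((m : ℤ) * n - m - n + 1).toNat) × Multiplicative ℤ) := by
  obtain ⟨p, rfl⟩ := Nat.exists_eq_add_of_le' hm
  obtain ⟨q, rfl⟩ := Nat.exists_eq_add_of_le' hn
  have hrank : (((p + 1 : ℕ) : ℤ) * (q + 1 : ℕ) - (p + 1 : ℕ) - (q + 1 : ℕ) + 1).toNat
      = p * q := by
    rw [← Int.toNat_natCast (p * q)]
    congr 1
    push_cast
    ring
  rw [hrank]
  exact ⟨(TorusKnotGroup.embedding p q).range, TorusKnotGroup.index_range_embedding,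
    ⟨(MonoidHom.ofInjective TorusKnotGroup.embedding_injective).symm.trans <|
      (FreeGroup.freeGroupCongr finProdFinEquiv).prodCongr (MulEquiv.refl _)⟩⟩
end
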